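/- arXiv:1110.1020 — 3 statements merged into one kernel-verified Lean document; each statement's English description precedes it below -/
import Mathlib

section
/- Let n ≥ 1 and let ℂⁿ = H_S ⊕ H_R be an orthogonal decomposition with orthogonal projections Π_S and Π_R = I − Π_S. Let H ∈ M_n(ℂ) be Hermitian and L_1, …, L_r ∈ M_n(ℂ), with Lindblad generator 𝓛. Then H_S is invariant for the master equation (i.e. for every density matrix ρ supported in H_S and every t ≥ 0, exp(t𝓛)(ρ) is supported in H_S) if and only if Π_R L_k Π_S = 0 for every k and Π_S (i·H − (1/2)·Σ_k L_k† L_k) Π_R = 0. -/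
open scoped Matrix ComplexOrder

noncomputable section

attribute [local instance] Matrix.normedAddCommGroup Matrix.normedSpace

abbrev Mat (n : ℕ) := Matrix (Fin n) (Fin n) ℂ

/-- The Lindblad generator `𝓛(ρ) = −i[H,ρ] + Σ_k (L_k ρ L_k† − ½(L_k† L_k ρ + ρ L_k† L_k))`. -/
def lindblad {n r : ℕ} (H : Mat n) (L : Fin r → Mat n) : Mat n →ₗ[ℂ] Mat n :=
  (-Complex.I) • (LinearMap.mulLeft ℂ H - LinearMap.mulRight ℂ H)
    + ∑ k, ((LinearMap.mulRight ℂ (L k)ᴴ).comp (LinearMap.mulLeft ℂ (L k))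
        - (1/2 : ℂ) • (LinearMap.mulLeft ℂ ((L k)ᴴ * L k)
            + LinearMap.mulRight ℂ ((L k)ᴴ * L k)))

/-- `evol H L t ρ = exp (t 𝓛) ρ`, the solution of the master equation at time `t`. -/
def evol {n r : ℕ} (H : Mat n) (L : Fin r → Mat n) (t : ℝ) (ρ : Mat n) : Mat n :=
  haveI : IsTopologicalRing (Mat n →L[ℂ] Mat n) :=
    inferInstanceAs (IsTopologicalRing ((Fin n → Fin n → ℂ) →L[ℂ] (Fin n → Fin n → ℂ)))
  NormedSpace.exp ((t : ℂ) • (lindblad H L).toContinuousLinearMap) ρ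

/-- The exponential of a bounded operator preserves every closed invariant subspace. -/
lemma exp_apply_mem_of_invariant {E : Type*} [NormedAddCommGroup E] [NormedSpace ℂ E]
    [CompleteSpace E] (A : E →L[ℂ] E) (W : Submodule ℂ E) (hW : IsClosed (W : Set E))
    (hA : ∀ x ∈ W, A x ∈ W) {x : E} (hx : x ∈ W) : NormedSpace.exp A x ∈ W := by
  have hpow : ∀ m : ℕ, (A ^ m) x ∈ W := by
    intro m
    induction m with
    | zero => simpa using hx
    | succ m ih =>
      rw [pow_succ', mul_apply_eq_comp]
      exact hA _ ih
  have hsum := (NormedSpace.exp_series_hasSum_exp' (𝕂 := ℂ) A).mapL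
    (ContinuousLinearMap.apply ℂ E x)
  exact hW.mem_of_tendsto hsum <| Filter.Eventually.of_forall fun s =>
    W.sum_mem fun m _ => W.smul_mem _ (hpow m)

/-- If the forward orbit of `x` under `exp (t A)` stays in a closed subspace, then so does `A x`. -/
lemma apply_mem_of_exp_smul_apply_mem {E : Type*} [NormedAddCommGroup E] [NormedSpace ℂ E]
    [CompleteSpace E] (A : E →L[ℂ] E) (W : Submodule ℂ E) (hW : IsClosed (W : Set E)) {x : E}
    (hx : ∀ t : ℝ, 0 ≤ t → NormedSpace.exp ((t : ℂ) • A) x ∈ W) : A x ∈ W := by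
  have hderiv : HasDerivAt (fun t : ℝ => NormedSpace.exp ((t : ℂ) • A) x) (A x) 0 := by
    have h := (hasDerivAt_exp_smul_const A ((0 : ℝ) : ℂ)).scomp (0 : ℝ)
      Complex.ofRealCLM.hasDerivAt
    have h' := ((ContinuousLinearMap.apply ℂ E x).restrictScalars ℝ).hasFDerivAt.comp_hasDerivAt
      (0 : ℝ) h
    simpa [Function.comp_def] using h'
  refine hW.mem_of_tendsto hderiv.tendsto_slope_zero_right ?_
  filter_upwards [self_mem_nhdsWithin] with t ht
  have ht' : (0 : ℝ) < t := ht
  have hmem := W.smul_mem ((t⁻¹ : ℝ) : ℂ)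
    (W.sub_mem (hx (0 + t) (by linarith)) (hx 0 le_rfl))
  rwa [Complex.coe_smul] at hmem

/-- The matrices supported in the range of the projection `P`. -/
def supportedMatrices {n : ℕ} (P : Mat n) : Submodule ℂ (Mat n) :=
  LinearMap.eqLocus ((LinearMap.mulRight ℂ P).comp (LinearMap.mulLeft ℂ P)) LinearMap.id

lemma mem_supportedMatrices {n : ℕ} {P X : Mat n} :
    X ∈ supportedMatrices P ↔ P * X * P = X := by
  simp [supportedMatrices, LinearMap.mem_eqLocus]

lemma isClosed_supportedMatrices {n : ℕ} (P : Mat n) :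
    IsClosed (supportedMatrices P : Set (Mat n)) :=
  (supportedMatrices P).closed_of_finiteDimensional

lemma evol_mem_supportedMatrices {n r : ℕ} {P H : Mat n} {L : Fin r → Mat n}
    (h : ∀ X ∈ supportedMatrices P, lindblad H L X ∈ supportedMatrices P) (t : ℝ) {ρ : Mat n}
    (hρ : ρ ∈ supportedMatrices P) : evol H L t ρ ∈ supportedMatrices P :=
  exp_apply_mem_of_invariant ((t : ℂ) • (lindblad H L).toContinuousLinearMap) _
    (isClosed_supportedMatrices P)
    (fun X hX => (supportedMatrices P).smul_mem _ (h X hX)) hρ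

lemma lindblad_mem_supportedMatrices {n r : ℕ} {P H : Mat n} {L : Fin r → Mat n} {ρ : Mat n}
    (h : ∀ t : ℝ, 0 ≤ t → evol H L t ρ ∈ supportedMatrices P) :
    lindblad H L ρ ∈ supportedMatrices P :=
  apply_mem_of_exp_smul_apply_mem (lindblad H L).toContinuousLinearMap _
    (isClosed_supportedMatrices P) h

lemma lindblad_apply {n r : ℕ} {H : Mat n} (hH : H.IsHermitian) (L : Fin r → Mat n) (ρ : Mat n) :
    lindblad H L ρ = (Complex.I • H - (1/2 : ℂ) • ∑ k, (L k)ᴴ * L k)ᴴ * ρ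
      + ρ * (Complex.I • H - (1/2 : ℂ) • ∑ k, (L k)ᴴ * L k) + ∑ k, L k * ρ * (L k)ᴴ := by
  simp only [lindblad, LinearMap.add_apply, LinearMap.smul_apply, LinearMap.sub_apply,
    LinearMap.sum_apply, LinearMap.comp_apply, LinearMap.mulLeft_apply, LinearMap.mulRight_apply,
    Matrix.conjTranspose_sub, Matrix.conjTranspose_smul, Matrix.conjTranspose_sum,
    Matrix.conjTranspose_mul, Matrix.conjTranspose_conjTranspose, hH.eq, Finset.sum_sub_distrib,
    ← Finset.smul_sum, Finset.sum_add_distrib, ← Finset.sum_mul, ← Finset.mul_sum, sub_mul,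
    mul_sub, smul_mul_assoc, mul_smul_comm]
  have hI : star Complex.I = -Complex.I := Complex.conj_I
  have h2 : star (1 / 2 : ℂ) = 1 / 2 := by simp
  rw [hI, h2]
  module

/-- If a sum of matrices `A k * (A k)ᴴ` vanishes, then so does every `A k`. -/
lemma eq_zero_of_sum_mul_conjTranspose_eq_zero {n r : ℕ} {A : Fin r → Mat n}
    (h : ∑ k, A k * (A k)ᴴ = 0) (k : Fin r) : A k = 0 := by
  have htr : ∑ k, (A k * (A k)ᴴ).trace = 0 := by
    rw [← Matrix.trace_sum, h, Matrix.trace_zero]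
  rw [Finset.sum_eq_zero_iff_of_nonneg fun k _ =>
    (Matrix.posSemidef_self_mul_conjTranspose (A k)).trace_nonneg] at htr
  exact Matrix.trace_mul_conjTranspose_self_eq_zero_iff.mp (htr k (Finset.mem_univ k))

/-- The two block conditions make the matrices supported in the range of `P` invariant under the
generator. -/
lemma lindblad_mem_supportedMatrices_of_blocks {n r : ℕ} {P : Mat n} (hPH : P.IsHermitian)
    (hP : P * P = P) {H : Mat n} (hH : H.IsHermitian) {L : Fin r → Mat n}
    (hL : ∀ k, (1 - P) * L k * P = 0)
    (hG : P * (Complex.I • H - (1/2 : ℂ) • ∑ k, (L k)ᴴ * L k) * (1 - P) = 0)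
    {X : Mat n} (hX : X ∈ supportedMatrices P) : lindblad H L X ∈ supportedMatrices P := by
  rw [mem_supportedMatrices] at hX
  have hPX : P * X = X := by rw [← hX]; simp only [← mul_assoc, hP]
  have hXP : X * P = X := by rw [← hX]; simp only [mul_assoc, hP]
  rw [lindblad_apply hH]
  set G := Complex.I • H - (1/2 : ℂ) • ∑ k, (L k)ᴴ * L k
  have hXG : X * G * P = X * G := by
    have h : X * (P * G * (1 - P)) = 0 := by rw [hG, mul_zero]
    simp only [← mul_assoc, hXP, mul_sub, mul_one] at h
    exact (sub_eq_zero.mp h).symm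
  have hGX : P * (Gᴴ * X) = Gᴴ * X := by
    have h : (P * G * (1 - P))ᴴ * X = 0 := by rw [hG, Matrix.conjTranspose_zero, zero_mul]
    simp only [Matrix.conjTranspose_mul, Matrix.conjTranspose_sub, Matrix.conjTranspose_one,
      hPH.eq, mul_assoc, hPX, sub_mul, one_mul] at h
    exact (sub_eq_zero.mp h).symm
  have hLX : ∀ k, P * (L k * X) = L k * X := by
    intro k
    have h : (1 - P) * L k * P * X = 0 := by rw [hL, zero_mul]
    simp only [mul_assoc, hPX, sub_mul, one_mul] at h
    exact (sub_eq_zero.mp h).symm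
  have hXL : ∀ k, X * (L k)ᴴ * P = X * (L k)ᴴ := by
    intro k
    have h : X * ((1 - P) * L k * P)ᴴ = 0 := by rw [hL, Matrix.conjTranspose_zero, mul_zero]
    simp only [Matrix.conjTranspose_mul, Matrix.conjTranspose_sub, Matrix.conjTranspose_one,
      hPH.eq, ← mul_assoc, hXP, mul_sub, mul_one] at h
    exact (sub_eq_zero.mp h).symm
  refine add_mem (add_mem ?_ ?_) (sum_mem fun k _ => ?_) <;> rw [mem_supportedMatrices]
  · rw [hGX, mul_assoc, hXP]
  · rw [← mul_assoc, hPX, hXG]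
  · rw [← mul_assoc, hLX, mul_assoc, mul_assoc, ← mul_assoc X, hXL, mul_assoc]

/-- If the generator maps `P` to a matrix supported in the range of `P`, then the two block
conditions hold. -/
lemma blocks_of_lindblad_self_mem_supportedMatrices {n r : ℕ} {P : Mat n} (hPH : P.IsHermitian)
    (hP : P * P = P) {H : Mat n} (hH : H.IsHermitian) {L : Fin r → Mat n}
    (h : lindblad H L P ∈ supportedMatrices P) :
    (∀ k, (1 - P) * L k * P = 0) ∧
      P * (Complex.I • H - (1/2 : ℂ) • ∑ k, (L k)ᴴ * L k) * (1 - P) = 0 := by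
  have hPQ : P * (1 - P) = 0 := by rw [mul_sub, mul_one, hP, sub_self]
  have hlQ : lindblad H L P * (1 - P) = 0 := by
    rw [← mem_supportedMatrices.mp h, mul_assoc, hPQ, mul_zero]
  rw [lindblad_apply hH] at hlQ
  set G := Complex.I • H - (1/2 : ℂ) • ∑ k, (L k)ᴴ * L k
  rw [add_mul, add_mul, mul_assoc Gᴴ, hPQ, mul_zero, zero_add, Finset.sum_mul] at hlQ
  have hL : ∀ k, (1 - P) * L k * P = 0 := by
    refine eq_zero_of_sum_mul_conjTranspose_eq_zero ?_
    have hQ : (1 - P) * (P * G * (1 - P) + ∑ k, L k * P * (L k)ᴴ * (1 - P)) = 0 := by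
      rw [hlQ, mul_zero]
    have hQP : (1 - P) * P = 0 := by rw [sub_mul, one_mul, hP, sub_self]
    rw [mul_add, ← mul_assoc, ← mul_assoc, hQP, zero_mul, zero_mul, zero_add,
      Finset.mul_sum] at hQ
    rw [← hQ]
    refine Finset.sum_congr rfl fun k _ => ?_
    simp only [Matrix.conjTranspose_mul, Matrix.conjTranspose_sub, Matrix.conjTranspose_one,
      hPH.eq]
    rw [← mul_assoc, mul_assoc _ P P, hP]
    simp only [mul_assoc]
  refine ⟨hL, ?_⟩
  have hsum : ∑ k, L k * P * (L k)ᴴ * (1 - P) = 0 := by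
    refine Finset.sum_eq_zero fun k _ => ?_
    have hk : P * ((L k)ᴴ * (1 - P)) = 0 := by
      simpa [hPH.eq] using congrArg Matrix.conjTranspose (hL k)
    rw [mul_assoc, mul_assoc, hk, mul_zero]
  rwa [hsum, add_zero] at hlQ

/-- `H_S` is invariant for the master equation iff
`Π_R L_k Π_S = 0` for every `k` and `Π_S (iH − ½ Σ_k L_k† L_k) Π_R = 0`.
Here `PS` is the orthogonal projection onto `H_S` and `1 - PS` the one onto `H_R`. -/
theorem subspace_invariance_iff {n r : ℕ} (hn : 1 ≤ n)
    (PS : Mat n) (hPH : PS.IsHermitian) (hPidem : PS * PS = PS)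
    (H : Mat n) (hH : H.IsHermitian) (L : Fin r → Mat n) :
    (∀ ρ : Mat n, ρ.PosSemidef → ρ.trace = 1 → PS * ρ * PS = ρ →
        ∀ t : ℝ, 0 ≤ t → PS * evol H L t ρ * PS = evol H L t ρ) ↔
    ((∀ k, (1 - PS) * L k * PS = 0) ∧
      PS * (Complex.I • H - (1/2 : ℂ) • ∑ k, (L k)ᴴ * L k) * (1 - PS) = 0) := by
  constructor
  · intro h
    refine blocks_of_lindblad_self_mem_supportedMatrices hPH hPidem hH ?_
    have hpos : PS.PosSemidef := by
      simpa only [hPH.eq, hPidem] using Matrix.posSemidef_self_mul_conjTranspose PS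
    rcases eq_or_ne PS 0 with rfl | hne
    · simp
    have htr : PS.trace ≠ 0 := hpos.trace_eq_zero_iff.not.mpr hne
    have hmem : lindblad H L (PS.trace⁻¹ • PS) ∈ supportedMatrices PS :=
      lindblad_mem_supportedMatrices fun t ht => mem_supportedMatrices.mpr <|
        h _ (hpos.smul (inv_nonneg.mpr hpos.trace_nonneg))
          (by rw [Matrix.trace_smul, smul_eq_mul, inv_mul_cancel₀ htr])
          (by rw [mul_smul_comm, smul_mul_assoc, hPidem, hPidem]) t ht
    rw [map_smul] at hmem
    exact ((supportedMatrices PS).smul_mem_iff (inv_ne_zero htr)).mp hmem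
  · rintro ⟨hL, hG⟩ ρ - - hρ t -
    exact mem_supportedMatrices.mp <| evol_mem_supportedMatrices
      (fun X => lindblad_mem_supportedMatrices_of_blocks hPH hPidem hH hL hG) t
      (mem_supportedMatrices.mpr hρ)
end
end

section
/- Let A ∈ M_n(ℂ) and let ℂⁿ = H_S ⊕ H_R be a direct-sum decomposition into subspaces. Assume that H_R contains no nonzero A-invariant subspace (equivalently, every subspace W ⊆ H_R with A·W ⊆ W is the zero subspace). Then for every x₀ ∈ H_R with x₀ ≠ 0 and every T > 0, there exists t ∈ [0, T] such that exp(t·A)·x₀ ∉ H_R. -/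
open scoped Matrix

noncomputable section

/-- A curve that lies in a closed real subspace near `t` has its derivative at `t` there too. -/
theorem HasDerivAt.mem_of_eventually_mem_submodule {E : Type*} [NormedAddCommGroup E]
    [NormedSpace ℝ E] {W : Submodule ℝ E} (hW : IsClosed (W : Set E)) {f : ℝ → E} {f' : E} {t : ℝ}
    (hf : HasDerivAt f f' t) (hmem : ∀ᶠ s in nhds t, f s ∈ W) : f' ∈ W := by
  refine hW.mem_of_tendsto hf.tendsto_slope ?_
  filter_upwards [hmem.filter_mono nhdsWithin_le_nhds] with s hs
  exact W.smul_mem _ (W.sub_mem hs hmem.self_of_nhds)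

/-- `t ↦ exp(tA) x` solves `ẋ = A x`. -/
theorem Matrix.hasDerivAt_exp_ofReal_smul_mulVec {m : Type*} [Fintype m] [DecidableEq m]
    (A : Matrix m m ℂ) (x : m → ℂ) (t : ℝ) :
    HasDerivAt (fun s : ℝ => NormedSpace.exp ((s : ℂ) • A) *ᵥ x)
      (A *ᵥ (NormedSpace.exp ((t : ℂ) • A) *ᵥ x)) t := by
  let _ : NormedRing (Matrix m m ℂ) := Matrix.linftyOpNormedRing
  let _ : NormedAlgebra ℂ (Matrix m m ℂ) := Matrix.linftyOpNormedAlgebra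
  have h := (hasDerivAt_exp_smul_const' (𝕂 := ℂ) A (t : ℂ)).scomp t
    (Complex.ofRealCLM.hasDerivAt (x := t))
  rw [Complex.ofRealCLM_apply, Complex.ofReal_one, one_smul] at h
  let L : Matrix m m ℂ →L[ℝ] (m → ℂ) :=
    LinearMap.toContinuousLinearMap (((Matrix.mulVecBilin ℂ ℂ).flip x).restrictScalars ℝ)
  rw [Matrix.mulVec_mulVec]
  exact L.hasFDerivAt.comp_hasDerivAt t h

/-- If `ℂⁿ = H_S ⊕ H_R` and `H_R` contains no nonzero `A`-invariant
subspace, then for every nonzero `x₀ ∈ H_R` and every `T > 0` the trajectory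
`t ↦ exp(tA) x₀` leaves `H_R` at some time `t ∈ [0, T]`. -/
theorem trajectory_exits_subspace {n : ℕ} (A : Matrix (Fin n) (Fin n) ℂ)
    (HS HR : Submodule ℂ (Fin n → ℂ)) (hcompl : IsCompl HS HR)
    (hnoinv : ∀ W : Submodule ℂ (Fin n → ℂ), W ≤ HR → (∀ w ∈ W, A *ᵥ w ∈ W) → W = ⊥)
    (x₀ : Fin n → ℂ) (hx₀R : x₀ ∈ HR) (hx₀ : x₀ ≠ 0)
    (T : ℝ) (hT : 0 < T) :
    ∃ t ∈ Set.Icc (0 : ℝ) T, NormedSpace.exp ((t : ℂ) • A) *ᵥ x₀ ∉ HR := by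
  by_contra! hstay
  let γ : ℝ → Fin n → ℂ := fun t => NormedSpace.exp ((t : ℂ) • A) *ᵥ x₀
  let W : Submodule ℂ (Fin n → ℂ) := Submodule.span ℂ (γ '' Set.Ioo 0 T)
  have hγW : ∀ t ∈ Set.Ioo 0 T, γ t ∈ W := fun t ht =>
    Submodule.subset_span (Set.mem_image_of_mem γ ht)
  have hWR : W ≤ HR := by
    refine Submodule.span_le.2 ?_
    rintro _ ⟨t, ht, rfl⟩
    exact hstay t (Set.Ioo_subset_Icc_self ht)
  have hinv : W ≤ W.comap A.mulVecLin := by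
    refine Submodule.span_le.2 ?_
    rintro _ ⟨t, ht, rfl⟩
    refine HasDerivAt.mem_of_eventually_mem_submodule (W := W.restrictScalars ℝ)
      W.closed_of_finiteDimensional (A.hasDerivAt_exp_ofReal_smul_mulVec x₀ t) ?_
    filter_upwards [isOpen_Ioo.mem_nhds ht] with s hs using hγW s hs
  have hzero : γ (T / 2) = 0 := by
    have h := hγW (T / 2) ⟨half_pos hT, half_lt_self hT⟩
    rwa [hnoinv W hWR hinv, Submodule.mem_bot] at h
  exact hx₀ (Matrix.mulVec_injective_of_isUnit (Matrix.isUnit_exp _)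
    (hzero.trans (Matrix.mulVec_zero _).symm))
end
end

section
/- Let A ∈ M_n(ℂ), C ∈ M_{m,n}(ℂ), x ∈ ℂⁿ, and T > 0. Then C·(exp(t·A)·x) = 0 for all t ∈ [0, T] if and only if C·(A^k·x) = 0 for all natural numbers k < n. -/
open scoped Matrix

noncomputable section

section BanachAlgebra

variable {𝔸 E : Type*} [NormedRing 𝔸] [NormedAlgebra ℝ 𝔸] [CompleteSpace 𝔸]
  [NormedAddCommGroup E] [NormedSpace ℝ E]

/-- If a continuous linear map kills `exp (t • a)` on a nondegenerate interval, then it kills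
`a ^ k * exp (t • a)` there for every `k`. -/
theorem map_pow_mul_exp_smul_eq_zero (L : 𝔸 →L[ℝ] E) (a : 𝔸) {T : ℝ} (hT : 0 < T)
    (h : ∀ t ∈ Set.Icc (0 : ℝ) T, L (NormedSpace.exp (t • a)) = 0) (k : ℕ) :
    ∀ t ∈ Set.Icc (0 : ℝ) T, L (a ^ k * NormedSpace.exp (t • a)) = 0 := by
  induction k with
  | zero => simpa using h
  | succ k ih =>
    intro t ht
    have hderiv : HasDerivAt (fun s : ℝ => L (a ^ k * NormedSpace.exp (s • a)))
        (L (a ^ k * (a * NormedSpace.exp (t • a)))) t :=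
      L.hasFDerivAt.comp_hasDerivAt t ((hasDerivAt_exp_smul_const' a t).const_mul (a ^ k))
    have hzero : HasDerivWithinAt (fun s : ℝ => L (a ^ k * NormedSpace.exp (s • a))) 0
        (Set.Icc 0 T) t :=
      (hasDerivWithinAt_const t (Set.Icc 0 T) (0 : E)).congr ih (ih t ht)
    rw [pow_succ, mul_assoc]
    exact (uniqueDiffOn_Icc hT t ht).eq_deriv _ hderiv.hasDerivWithinAt hzero

/-- A continuous linear map kills `exp (t • a)` on a nondegenerate interval `[0, T]` iff it kills
all powers of `a`. -/
theorem map_exp_smul_eq_zero_iff (L : 𝔸 →L[ℝ] E) (a : 𝔸) {T : ℝ} (hT : 0 < T) :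
    (∀ t ∈ Set.Icc (0 : ℝ) T, L (NormedSpace.exp (t • a)) = 0) ↔ ∀ k : ℕ, L (a ^ k) = 0 := by
  refine ⟨fun h k => ?_, fun h t _ => ?_⟩
  · simpa using map_pow_mul_exp_smul_eq_zero L a hT h k 0 ⟨le_rfl, hT.le⟩
  · refine (L.hasSum (NormedSpace.exp_series_hasSum_exp' (𝕂 := ℝ) (t • a))).unique ?_
    simp [smul_pow, h]

end BanachAlgebra

/-- By Cayley–Hamilton, a linear map that kills `A ^ k` for all `k < n` kills all powers
of the `n × n` matrix `A`. -/
theorem Matrix.map_pow_eq_zero_of_lt {R M : Type*} [CommRing R] [Nontrivial R] [AddCommGroup M]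
    [Module R M] {n : ℕ} (A : Matrix (Fin n) (Fin n) R) (L : Matrix (Fin n) (Fin n) R →ₗ[R] M)
    (h : ∀ k < n, L (A ^ k) = 0) (k : ℕ) : L (A ^ k) = 0 := by
  rw [A.pow_eq_aeval_mod_charpoly, Polynomial.aeval_eq_sum_range, map_sum]
  refine Finset.sum_eq_zero fun i hi => ?_
  rw [map_smul]
  by_cases hin : i < n
  · rw [h i hin, smul_zero]
  · rw [Polynomial.coeff_eq_zero_of_degree_lt, zero_smul]
    refine (Polynomial.degree_modByMonic_lt _ A.charpoly_monic).trans_le ?_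
    rw [A.charpoly_degree_eq_dim, Fintype.card_fin]
    exact_mod_cast not_lt.mp hin

/-- The output `C exp(tA) x` vanishes on `[0, T]` (with `T > 0`) iff
`x` lies in the kernel of all observability matrices `C A^k`, `k = 0, …, n−1`. -/
theorem unobservable_subspace_characterization {n m : ℕ}
    (A : Matrix (Fin n) (Fin n) ℂ) (C : Matrix (Fin m) (Fin n) ℂ)
    (x : Fin n → ℂ) (T : ℝ) (hT : 0 < T) :
    (∀ t ∈ Set.Icc (0 : ℝ) T, C *ᵥ (NormedSpace.exp ((t : ℂ) • A) *ᵥ x) = 0) ↔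
    (∀ k : ℕ, k < n → C *ᵥ ((A ^ k) *ᵥ x) = 0) := by
  let _ : NormedRing (Matrix (Fin n) (Fin n) ℂ) := Matrix.linftyOpNormedRing
  let _ : NormedAlgebra ℝ (Matrix (Fin n) (Fin n) ℂ) := Matrix.linftyOpNormedAlgebra
  let L : Matrix (Fin n) (Fin n) ℂ →ₗ[ℂ] (Fin m → ℂ) :=
    C.mulVecLin ∘ₗ (Matrix.mulVecBilin ℂ ℂ).flip x
  let L' : Matrix (Fin n) (Fin n) ℂ →L[ℝ] (Fin m → ℂ) :=
    (L.restrictScalars ℝ).toContinuousLinearMap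
  have key := map_exp_smul_eq_zero_iff L' A hT
  simp only [Complex.coe_smul]
  exact key.trans ⟨fun h k _ => h k, fun h => A.map_pow_eq_zero_of_lt L h⟩
end
end
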